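/- The number of monotone Boolean functions of 8 variables that are fixed points of the 4-cycle of Fin 8 given by (0 1 2 3) equals 424234996. -/

import Mathlib

open Finset

/-! ### Numerical codes of monotone Boolean functions -/

/-- The truth table of `h`, read as a binary number. -/
def truthCode : (n : ℕ) → ((Fin n → Bool) → Bool) → ℕ
  | 0, h => (h Fin.elim0).toNat
  | n + 1, h => 2 ^ 2 ^ n * truthCode n (fun x => h (Fin.cons true x)) +
      truthCode n (fun x => h (Fin.cons false x))

theorem truthCode_lt (n : ℕ) (h : (Fin n → Bool) → Bool) : truthCode n h < 2 ^ 2 ^ n := by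
  induction n with
  | zero => cases hb : h Fin.elim0 <;> simp [truthCode, hb]
  | succ n ih =>
    have h1 := ih fun x => h (Fin.cons true x)
    have h0 := ih fun x => h (Fin.cons false x)
    rw [truthCode, pow_succ, pow_mul, sq]
    nlinarith

theorem two_pow_mul_add_land {k a b c d : ℕ} (ha : a < 2 ^ k) (hc : c < 2 ^ k) :
    (2 ^ k * b + a) &&& (2 ^ k * d + c) = 2 ^ k * (b &&& d) + (a &&& c) := by
  have hac : a &&& c < 2 ^ k := Nat.and_lt_two_pow _ hc
  apply Nat.eq_of_testBit_eq
  intro i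
  rw [Nat.testBit_and, Nat.testBit_two_pow_mul_add _ ha, Nat.testBit_two_pow_mul_add _ hc,
    Nat.testBit_two_pow_mul_add _ hac]
  split_ifs <;> simp

theorem two_pow_mul_add_inj {k a b c d : ℕ} (ha : a < 2 ^ k) (hc : c < 2 ^ k) :
    2 ^ k * b + a = 2 ^ k * d + c ↔ b = d ∧ a = c := by
  refine ⟨fun h => ?_, by rintro ⟨rfl, rfl⟩; rfl⟩
  have hk : 0 < 2 ^ k := by positivity
  have h1 := congrArg (· / 2 ^ k) h
  have h2 := congrArg (· % 2 ^ k) h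
  simp only [Nat.mul_add_div hk, Nat.div_eq_of_lt ha, Nat.div_eq_of_lt hc, Nat.mul_add_mod,
    Nat.mod_eq_of_lt ha, Nat.mod_eq_of_lt hc] at h1 h2
  exact ⟨h1, h2⟩

theorem le_iff_forall_cons {n : ℕ} {g h : (Fin (n + 1) → Bool) → Bool} :
    g ≤ h ↔ (fun x => g (Fin.cons true x)) ≤ (fun x => h (Fin.cons true x)) ∧
      (fun x => g (Fin.cons false x)) ≤ (fun x => h (Fin.cons false x)) := by
  refine ⟨fun H => ⟨fun x => H _, fun x => H _⟩, fun ⟨H1, H0⟩ x => ?_⟩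
  rw [← Fin.cons_self_tail x]
  cases x 0
  · exact H0 (Fin.tail x)
  · exact H1 (Fin.tail x)

theorem monotone_iff_cons {n : ℕ} {h : (Fin (n + 1) → Bool) → Bool} :
    Monotone h ↔ Monotone (fun x => h (Fin.cons true x)) ∧
      Monotone (fun x => h (Fin.cons false x)) ∧
      (fun x => h (Fin.cons false x)) ≤ (fun x => h (Fin.cons true x)) := by
  constructor
  · intro H
    exact ⟨fun x y hxy => H (Fin.cons_le_cons.2 ⟨le_rfl, hxy⟩),
      fun x y hxy => H (Fin.cons_le_cons.2 ⟨le_rfl, hxy⟩),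
      fun x => H (Fin.cons_le_cons.2 ⟨Bool.false_le _, le_rfl⟩)⟩
  · rintro ⟨H1, H0, H01⟩ x y hxy
    have ht : Fin.tail x ≤ Fin.tail y := fun i => hxy i.succ
    have h0 := hxy 0
    rw [← Fin.cons_self_tail x, ← Fin.cons_self_tail y]
    revert h0
    cases x 0 <;> cases y 0 <;> intro h0
    · exact H0 ht
    · exact (H0 ht).trans (H01 _)
    · exact absurd h0 (not_le_of_gt Bool.false_lt_true)
    · exact H1 ht

theorem truthCode_land_eq_iff {n : ℕ} {g h : (Fin n → Bool) → Bool} :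
    truthCode n g &&& truthCode n h = truthCode n g ↔ g ≤ h := by
  induction n with
  | zero =>
    have : g ≤ h ↔ g Fin.elim0 ≤ h Fin.elim0 :=
      ⟨fun H => H _, fun H x => by rwa [Subsingleton.elim x Fin.elim0]⟩
    rw [this, truthCode, truthCode]
    generalize g Fin.elim0 = a
    generalize h Fin.elim0 = b
    revert a b
    decide
  | succ n ih =>
    rw [truthCode, truthCode, two_pow_mul_add_land (truthCode_lt _ _) (truthCode_lt _ _),
      two_pow_mul_add_inj (Nat.and_lt_two_pow _ (truthCode_lt _ _)) (truthCode_lt _ _), ih, ih,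
      ← le_iff_forall_cons]

theorem truthCode_injective (n : ℕ) : Function.Injective (truthCode n) := by
  intro g h H
  apply le_antisymm <;> rw [← truthCode_land_eq_iff, H, Nat.and_self]

/-- The codes of the monotone Boolean functions of `n` variables. -/
def monoCodes : ℕ → List ℕ
  | 0 => [0, 1]
  | n + 1 => (monoCodes n).flatMap fun u =>
      ((monoCodes n).filter fun v => Nat.beq (Nat.land u v) u).map fun v => 2 ^ 2 ^ n * v + u

theorem mem_monoCodes {n c : ℕ} :
    c ∈ monoCodes n ↔ ∃ h : (Fin n → Bool) → Bool, Monotone h ∧ truthCode n h = c := by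
  induction n generalizing c with
  | zero =>
    have key : ∀ b : Bool, ∃ h : (Fin 0 → Bool) → Bool, Monotone h ∧ truthCode 0 h = b.toNat :=
      fun b => ⟨fun _ => b, monotone_const, rfl⟩
    simp only [monoCodes, List.mem_cons, List.not_mem_nil, or_false]
    constructor
    · rintro (rfl | rfl)
      · exact key false
      · exact key true
    · rintro ⟨h, -, rfl⟩
      cases hb : h Fin.elim0 <;> simp [truthCode, hb]
  | succ n ih =>
    simp only [monoCodes, List.mem_flatMap, List.mem_map, List.mem_filter, Nat.beq_eq, ih]
    constructor
    · rintro ⟨_, ⟨g, hg, rfl⟩, _, ⟨⟨h, hh, rfl⟩, hgh⟩, rfl⟩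
      refine ⟨fun x => bif x 0 then h (Fin.tail x) else g (Fin.tail x), ?_, ?_⟩
      · rw [monotone_iff_cons]
        simpa using ⟨hh, hg, truthCode_land_eq_iff.1 hgh⟩
      · simp [truthCode]
    · rintro ⟨h, hh, rfl⟩
      obtain ⟨H1, H0, H01⟩ := monotone_iff_cons.1 hh
      exact ⟨_, ⟨_, H0, rfl⟩, _, ⟨⟨_, H1, rfl⟩, truthCode_land_eq_iff.2 H01⟩, rfl⟩

theorem nodup_monoCodes (n : ℕ) : (monoCodes n).Nodup := by
  induction n with
  | zero => decide
  | succ n ih =>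
    have hlt : ∀ c ∈ monoCodes n, c < 2 ^ 2 ^ n := by
      intro c hc
      obtain ⟨h, -, rfl⟩ := mem_monoCodes.1 hc
      exact truthCode_lt n h
    rw [monoCodes, List.nodup_flatMap]
    refine ⟨fun u hu => (ih.filter _).map fun v w h =>
      ((two_pow_mul_add_inj (hlt u hu) (hlt u hu)).1 h).1, ih.imp_of_mem fun hu hu' hne => ?_⟩
    simp only [Function.onFun, List.disjoint_left, List.mem_map]
    rintro _ ⟨v, -, rfl⟩ ⟨w, -, h⟩
    exact hne ((two_pow_mul_add_inj (hlt _ hu') (hlt _ hu)).1 h).2.symm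

/-- Monotone Boolean functions of `n` variables, with the pointwise order. -/
abbrev MonoFun (n : ℕ) := {h : (Fin n → Bool) → Bool // Monotone h}

noncomputable instance (n : ℕ) : Fintype (MonoFun n) := Fintype.ofFinite _

theorem map_truthCode_perm (n : ℕ) :
    (univ : Finset (MonoFun n)).toList.map (fun h => truthCode n h.1) |>.Perm (monoCodes n) := by
  rw [List.perm_ext_iff_of_nodup _ (nodup_monoCodes n)]
  · intro c
    simp [mem_monoCodes]
  · exact (Finset.nodup_toList _).map ((truthCode_injective n).comp Subtype.val_injective)

theorem sum_map_monoCodes (n : ℕ) (F : ℕ → ℕ) :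
    ((monoCodes n).map F).sum = ∑ h : MonoFun n, F (truthCode n h.1) := by
  rw [← ((map_truthCode_perm n).map F).sum_eq, List.map_map, ← Finset.sum_map_toList]
  rfl

/-! ### Reduction to chains of monotone Boolean functions of four variables -/

/-- The index of the rotation orbit of a word of length four; the orbits `2` and `3` of words with
two ones are incomparable, all other pairs are ordered as their indices. -/
def orbitIndex (u : Fin 4 → Bool) : Fin 6 :=
  match u 0, u 1, u 2, u 3 with
  | false, false, false, false => 0
  | true, false, false, false | false, true, false, false
  | false, false, true, false | false, false, false, true => 1
  | true, true, false, false | false, true, true, false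
  | false, false, true, true | true, false, false, true => 2
  | true, false, true, false | false, true, false, true => 3
  | true, true, true, true => 5
  | _, _, _, _ => 4

/-- A representative of each rotation orbit. -/
def orbitRep : Fin 6 → Fin 4 → Bool :=
  ![![false, false, false, false], ![true, false, false, false], ![true, true, false, false],
    ![true, false, true, false], ![true, true, true, false], ![true, true, true, true]]

/-- The order of the rotation orbits of words of length four. -/
def OrbitLE (i j : Fin 6) : Prop := i ≤ j ∧ ¬(i = 2 ∧ j = 3)

instance : DecidableRel OrbitLE := fun _ _ => inferInstanceAs (Decidable (_ ∧ _))

/-- The rotation of a word of length four. -/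
def rotate (u : Fin 4 → Bool) : Fin 4 → Bool := fun i => u (i + 1)

theorem orbitIndex_orbitRep : ∀ i, orbitIndex (orbitRep i) = i := by decide

theorem orbitRep_mono : ∀ i j, OrbitLE i j → ∀ k, orbitRep i k ≤ orbitRep j k := by decide

theorem orbitIndex_mono : ∀ u v, (∀ k, u k ≤ v k) → OrbitLE (orbitIndex u) (orbitIndex v) := by
  decide +kernel

theorem orbitIndex_rotate : ∀ u, orbitIndex (rotate u) = orbitIndex u := by decide +kernel

theorem exists_rotate_eq_orbitRep :
    ∀ u, ∃ k : Fin 4, rotate^[k] u = orbitRep (orbitIndex u) := by decide +kernel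

theorem append_le_append {m n : ℕ} {u u' : Fin m → Bool} {v v' : Fin n → Bool} (hu : u ≤ u')
    (hv : v ≤ v') : Fin.append u v ≤ Fin.append u' v' :=
  Fin.addCases (fun i => by simpa using hu i) (fun i => by simpa using hv i)

theorem exists_eq_append (x : Fin 8 → Bool) : ∃ u v : Fin 4 → Bool, x = Fin.append u v :=
  ⟨_, _, (Fin.append_castAdd_natAdd (m := 4) (n := 4) (f := x)).symm⟩

theorem append_comp_cycle (u v : Fin 4 → Bool) :
    (Fin.append u v : Fin 8 → Bool) ∘ (c[0, 1, 2, 3] : Equiv.Perm (Fin 8)) =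
      Fin.append (rotate u) v := by
  have hl : ∀ i : Fin 4, (c[0, 1, 2, 3] : Equiv.Perm (Fin 8)) (Fin.castAdd 4 i) =
      Fin.castAdd 4 (i + 1) := by decide
  have hr : ∀ i : Fin 4, (c[0, 1, 2, 3] : Equiv.Perm (Fin 8)) (Fin.natAdd 4 i) =
      Fin.natAdd 4 i := by decide
  refine funext (Fin.addCases (m := 4) (n := 4) (fun i => ?_) fun i => ?_)
  · rw [Function.comp_apply, hl, Fin.append_left, Fin.append_left, rotate]
  · rw [Function.comp_apply, hr, Fin.append_right, Fin.append_right]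

/-- Functions invariant under rotating the first four variables are order-preserving families
indexed by the orbits. -/
def invariantEquiv :
    {f : (Fin 8 → Bool) → Bool //
      Monotone f ∧ ∀ x : Fin 8 → Bool, f (x ∘ (c[0, 1, 2, 3] : Equiv.Perm (Fin 8))) = f x} ≃
    {t : Fin 6 → MonoFun 4 // ∀ i j, OrbitLE i j → t i ≤ t j} where
  toFun f := ⟨fun i => ⟨fun v => f.1 (Fin.append (orbitRep i) v : Fin 8 → Bool), fun v w h =>
      f.2.1 (append_le_append le_rfl h)⟩,
    fun i j h v => f.2.1 (append_le_append (orbitRep_mono i j h) le_rfl)⟩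
  invFun t := ⟨fun x => (t.1 (orbitIndex fun i => x (Fin.castAdd 4 i))).1
      fun i => x (Fin.natAdd 4 i), fun x y h =>
        ((t.1 _).2 fun i => h (Fin.natAdd 4 i)).trans
          (t.2 _ _ (orbitIndex_mono _ _ fun i => h (Fin.castAdd 4 i)) _), fun x => by
      obtain ⟨u, v, rfl⟩ := exists_eq_append x
      simp only [append_comp_cycle, Fin.append_left, Fin.append_right]
      rw [orbitIndex_rotate]⟩
  left_inv f := by
    obtain ⟨f, hf, hc⟩ := f
    ext x
    obtain ⟨u, v, rfl⟩ := exists_eq_append x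
    obtain ⟨k, hk⟩ := exists_rotate_eq_orbitRep u
    have key : ∀ k : ℕ, f (Fin.append (rotate^[k] u) v : Fin 8 → Bool) =
        f (Fin.append u v : Fin 8 → Bool) := by
      intro k
      induction k with
      | zero => rfl
      | succ k ih => rw [Function.iterate_succ_apply', ← append_comp_cycle, hc, ih]
    simp only [Fin.append_left, Fin.append_right]
    rw [← hk, key]
  right_inv t := by
    ext i v
    simp only [Fin.append_left, Fin.append_right]
    rw [orbitIndex_orbitRep]

/-- An order-preserving family indexed by the orbits, split at its entries `1` and `4`. -/
def chainEquiv (M : Type*) [PartialOrder M] :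
    {t : Fin 6 → M // ∀ i j, OrbitLE i j → t i ≤ t j} ≃
    Σ p : M, Σ r : M, {a // a ≤ p} × {b // p ≤ b ∧ b ≤ r} × {b // p ≤ b ∧ b ≤ r} × {d // r ≤ d} where
  toFun t := ⟨t.1 1, t.1 4, ⟨t.1 0, t.2 _ _ (by decide)⟩,
    ⟨t.1 2, t.2 _ _ (by decide), t.2 _ _ (by decide)⟩,
    ⟨t.1 3, t.2 _ _ (by decide), t.2 _ _ (by decide)⟩, ⟨t.1 5, t.2 _ _ (by decide)⟩⟩
  invFun s := ⟨![s.2.2.1.1, s.1, s.2.2.2.1.1, s.2.2.2.2.1.1, s.2.1, s.2.2.2.2.2.1], by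
    obtain ⟨p, r, ⟨a, ha⟩, ⟨b, hb, hb'⟩, ⟨c, hc, hc'⟩, ⟨d, hd⟩⟩ := s
    have hpr := hb.trans hb'
    have hbd := hb'.trans hd
    have hcd := hc'.trans hd
    have hab := ha.trans hb
    have hac := ha.trans hc
    have hpd := hpr.trans hd
    have har := ha.trans hpr
    have had := ha.trans hpd
    intro i j h
    fin_cases i <;> fin_cases j <;>
      first
      | exact absurd h (by decide)
      | exact le_rfl
      | assumption⟩
  left_inv t := by
    ext i
    fin_cases i <;> rfl
  right_inv s := rfl

theorem card_chains (M : Type*) [PartialOrder M] [Fintype M] [DecidableLE M] :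
    Nat.card {t : Fin 6 → M // ∀ i j, OrbitLE i j → t i ≤ t j} =
      ∑ p : M, ∑ r : M, #{a | a ≤ p} * (#{b | p ≤ b ∧ b ≤ r} * (#{b | p ≤ b ∧ b ≤ r} *
        #{d | r ≤ d})) := by
  rw [Nat.card_congr (chainEquiv M)]
  simp only [Nat.card_eq_fintype_card, Fintype.card_sigma, Fintype.card_prod, Fintype.card_subtype]

/-! ### The computation

The functions below are written with recursors, and those named `with…` pass on evaluated arguments,
to keep the evaluation in the kernel short. -/

/-- `k n`, with `n` evaluated first. -/
def withValue {α : Type} (n : ℕ) (k : ℕ → α) : α :=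
  Nat.rec (k 0) (fun m _ => k (Nat.succ m)) n

/-- `k l`, with the entries of `l` evaluated first. -/
def withValues {α : Type} (l : List ℕ) (k : List ℕ → α) : α :=
  List.rec (fun k => k []) (fun x _ ih k => withValue x fun y => ih fun t => k (y :: t)) l k

/-- `k (l.filter q)`, with the filtered list evaluated first. -/
def withFilter {α : Type} (q : ℕ → Bool) (l : List ℕ) (k : List ℕ → α) : α :=
  List.rec (fun k => k []) (fun x _ ih k => Bool.rec (ih k) (ih fun t => k (x :: t)) (q x)) l k

/-- The sum of `F` over a list. -/
def sumMap (F : ℕ → ℕ) (l : List ℕ) : ℕ :=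
  List.rec 0 (fun x _ s => Nat.add (F x) s) l

/-- The order of truth tables. -/
def leCode (x y : ℕ) : Bool := Nat.beq (Nat.land x y) x

/-- The indicator of the order of truth tables. -/
def leInd (x y : ℕ) : ℕ := Bool.rec 0 1 (Nat.beq (Nat.land x y) x)

/-- The sum over all `p ≤ r` of the product of the number of entries below `p`, the squared number
of entries between `p` and `r`, and the number of entries above `r`. -/
def chainCount (l : List ℕ) : ℕ :=
  sumMap (fun p => withFilter (leCode p) l fun lp =>
    Nat.mul (sumMap (fun x => leInd x p) l)
      (sumMap (fun r => withValue (sumMap (fun x => leInd x r) lp) fun c =>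
        Nat.mul c (Nat.mul c (sumMap (leInd r) l))) lp)) l

theorem withValue_eq {α : Type} (n : ℕ) (k : ℕ → α) : withValue n k = k n := by
  cases n <;> rfl

theorem withValues_eq {α : Type} (l : List ℕ) (k : List ℕ → α) : withValues l k = k l := by
  induction l generalizing k with
  | nil => rfl
  | cons x l ih =>
    change withValue x (fun y => withValues l fun t => k (y :: t)) = _
    rw [withValue_eq, ih]

theorem withFilter_eq {α : Type} (q : ℕ → Bool) (l : List ℕ) (k : List ℕ → α) :
    withFilter q l k = k (l.filter q) := by
  induction l generalizing k with
  | nil => rfl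
  | cons x l ih =>
    change (Bool.rec (withFilter q l k) (withFilter q l fun t => k (x :: t)) (q x) : α) = _
    cases h : q x <;> simp [h, ih]

theorem sumMap_eq (F : ℕ → ℕ) (l : List ℕ) : sumMap F l = (l.map F).sum := by
  induction l with
  | nil => rfl
  | cons x l ih => exact congrArg (F x + ·) ih

theorem sum_map_filter_eq (q : ℕ → Bool) (F : ℕ → ℕ) (l : List ℕ) :
    ((l.filter q).map F).sum = (l.map fun x => if q x then F x else 0).sum := by
  induction l with
  | nil => rfl
  | cons x l ih => cases h : q x <;> simp [h, ih]

theorem leInd_eq (x y : ℕ) : leInd x y = if leCode x y then 1 else 0 := by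
  rw [leInd, leCode]
  cases Nat.beq (Nat.land x y) x <;> rfl

theorem leCode_truthCode {n : ℕ} (g h : MonoFun n) :
    leCode (truthCode n g.1) (truthCode n h.1) = true ↔ g ≤ h := by
  rw [leCode, Nat.beq_eq]
  exact truthCode_land_eq_iff

theorem chainCount_monoCodes (n : ℕ) [DecidableLE (MonoFun n)] :
    chainCount (monoCodes n) =
    ∑ p : MonoFun n, ∑ r : MonoFun n, #{a | a ≤ p} * (#{b | p ≤ b ∧ b ≤ r} *
      (#{b | p ≤ b ∧ b ≤ r} * #{d | r ≤ d})) := by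
  simp only [chainCount, withFilter_eq, withValue_eq, sumMap_eq, sum_map_filter_eq, leInd_eq,
    sum_map_monoCodes, leCode_truthCode, Nat.mul_eq, ← ite_and, ← Finset.card_filter,
    ← Finset.mul_sum]
  refine Finset.sum_congr rfl fun p _ => congrArg _ (Finset.sum_congr rfl fun r _ => ?_)
  split_ifs with hpr
  · rfl
  · have : #{b : MonoFun n | p ≤ b ∧ b ≤ r} = 0 := by
      rw [Finset.card_eq_zero, Finset.filter_eq_empty_iff]
      exact fun b _ hb => hpr (hb.1.trans hb.2)
    rw [this, zero_mul]

theorem chainCount_monoCodes_four : chainCount (monoCodes 4) = 424234996 := by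
  have h : withValues (monoCodes 4) chainCount = 424234996 := by decide +kernel
  rwa [withValues_eq] at h

/-- The number of monotone Boolean functions of 8 variables fixed by the
permutation (0 1 2 3) equals 424234996. -/
theorem card_fixed_mbf :
    Nat.card {f : (Fin 8 → Bool) → Bool //
      Monotone f ∧ ∀ x : Fin 8 → Bool, f (x ∘ (c[0, 1, 2, 3] : Equiv.Perm (Fin 8))) = f x} = 424234996 := by
  classical
  rw [Nat.card_congr invariantEquiv, card_chains, ← chainCount_monoCodes, chainCount_monoCodes_four]
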